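/- Let n ≥ 1, Q = 2n+2, q > 1, q' = q/(q−1). Let Φ : [0,∞) → [0,1] be C² with Φ ≡ 1 on [0,1/2] and Φ ≡ 0 on [1,∞), and assume C₄ := ∫_{{η̃ ∈ ℝ^{2n+1} : 1/2 ≤ |η̃|_ℍ² ≤ 1}} Φ(|η̃|_ℍ²)^{−1/(q−1)} (|Φ''(|η̃|_ℍ²)| + |Φ'(|η̃|_ℍ²)|)^{q'} dη̃ < ∞. Then there is a constant C > 0, independent of R, such that for every R > 0, setting φ₂(η) = Φ(|η|_ℍ²/R²), one has ∫_{ℝ^{2n+1}} φ₂(η)^{−1/(q−1)} |Δ_ℍ φ₂(η)|^{q'} dη ≤ C R^{Q − 2q'}, where the integrand is taken to be 0 on the set where φ₂ = 0. -/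

import Mathlib

open MeasureTheory Real

noncomputable section

/-- The underlying space of the Heisenberg group `ℍⁿ ≅ ℝ^{2n+1}`,
written as triples `η = (x, y, τ)` with `x y : Fin n → ℝ`, `τ : ℝ`. -/
abbrev Heis (n : ℕ) : Type := (Fin n → ℝ) × (Fin n → ℝ) × ℝ

/-- Unit vector in the `x_i` direction. -/
def eX (n : ℕ) (i : Fin n) : Heis n := (Pi.single i 1, 0, 0)

/-- Unit vector in the `y_i` direction. -/
def eY (n : ℕ) (i : Fin n) : Heis n := (0, Pi.single i 1, 0)

/-- Unit vector in the `τ` direction. -/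
def eT (n : ℕ) : Heis n := (0, 0, 1)

/-- Partial derivative of `f` at `p` in direction `v`. -/
def pd (n : ℕ) (v : Heis n) (f : Heis n → ℝ) (p : Heis n) : ℝ := fderiv ℝ f p v

/-- The sub-Laplacian on the Heisenberg group, in coordinates:
`Δ_ℍ u = Δ_{(x,y)} u + 4(|x|²+|y|²) ∂²_{ττ} u + 4 Σᵢ (yᵢ ∂²_{xᵢτ} u − xᵢ ∂²_{yᵢτ} u)`. -/
def subLap (n : ℕ) (f : Heis n → ℝ) (p : Heis n) : ℝ :=
  (∑ i : Fin n, (pd n (eX n i) (pd n (eX n i) f) p + pd n (eY n i) (pd n (eY n i) f) p))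
    + 4 * (∑ i : Fin n, ((p.1 i) ^ 2 + (p.2.1 i) ^ 2)) * pd n (eT n) (pd n (eT n) f) p
    + 4 * ∑ i : Fin n, (p.2.1 i * pd n (eX n i) (pd n (eT n) f) p
        - p.1 i * pd n (eY n i) (pd n (eT n) f) p)

/-- The Korányi norm `|η|_ℍ = ((|x|²+|y|²)² + τ²)^{1/4}`. -/
def kor (n : ℕ) (p : Heis n) : ℝ :=
  ((∑ i : Fin n, ((p.1 i) ^ 2 + (p.2.1 i) ^ 2)) ^ 2 + p.2.2 ^ 2) ^ ((1 : ℝ) / 4)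

/-- The squared horizontal radius `|x|² + |y|²`. -/
def hsq (n : ℕ) (p : Heis n) : ℝ := ∑ i : Fin n, ((p.1 i) ^ 2 + (p.2.1 i) ^ 2)

lemma hsq_nonneg (n : ℕ) (p : Heis n) : 0 ≤ hsq n p :=
  Finset.sum_nonneg fun _ _ => by positivity

lemma kor_sq (n : ℕ) (p : Heis n) : kor n p ^ 2 = √(hsq n p ^ 2 + p.2.2 ^ 2) := by
  have h : 0 ≤ hsq n p ^ 2 + p.2.2 ^ 2 := by positivity
  change ((hsq n p ^ 2 + p.2.2 ^ 2) ^ ((1 : ℝ) / 4)) ^ 2 = _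
  rw [← Real.rpow_natCast, ← Real.rpow_mul h, Real.sqrt_eq_rpow]
  norm_num

lemma kor_sq_sq (n : ℕ) (p : Heis n) : (kor n p ^ 2) ^ 2 = hsq n p ^ 2 + p.2.2 ^ 2 := by
  rw [kor_sq, Real.sq_sqrt (by positivity)]

lemma hsq_le_kor_sq (n : ℕ) (p : Heis n) : hsq n p ≤ kor n p ^ 2 := by
  rw [kor_sq]
  exact Real.le_sqrt_of_sq_le (by nlinarith [sq_nonneg p.2.2])

lemma continuous_kor_sq (n : ℕ) : Continuous fun p : Heis n => kor n p ^ 2 := by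
  simp only [kor_sq, hsq]
  fun_prop

lemma hasFDerivAt_fst_apply (n : ℕ) (i : Fin n) (p : Heis n) :
    HasFDerivAt (fun ζ : Heis n => ζ.1 i)
      ((ContinuousLinearMap.proj i).comp (ContinuousLinearMap.fst ℝ (Fin n → ℝ) _)) p :=
  ((ContinuousLinearMap.proj (R := ℝ) (φ := fun _ : Fin n => ℝ) i).comp
    (ContinuousLinearMap.fst ℝ (Fin n → ℝ) ((Fin n → ℝ) × ℝ))).hasFDerivAt

lemma hasFDerivAt_snd_fst_apply (n : ℕ) (i : Fin n) (p : Heis n) :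
    HasFDerivAt (fun ζ : Heis n => ζ.2.1 i)
      ((ContinuousLinearMap.proj i).comp ((ContinuousLinearMap.fst ℝ (Fin n → ℝ) ℝ).comp
        (ContinuousLinearMap.snd ℝ (Fin n → ℝ) _))) p :=
  ((ContinuousLinearMap.proj (R := ℝ) (φ := fun _ : Fin n => ℝ) i).comp
    ((ContinuousLinearMap.fst ℝ (Fin n → ℝ) ℝ).comp
      (ContinuousLinearMap.snd ℝ (Fin n → ℝ) ((Fin n → ℝ) × ℝ)))).hasFDerivAt

lemma hasFDerivAt_snd_snd (n : ℕ) (p : Heis n) :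
    HasFDerivAt (fun ζ : Heis n => ζ.2.2)
      ((ContinuousLinearMap.snd ℝ (Fin n → ℝ) ℝ).comp
        (ContinuousLinearMap.snd ℝ (Fin n → ℝ) _)) p :=
  ((ContinuousLinearMap.snd ℝ (Fin n → ℝ) ℝ).comp
      (ContinuousLinearMap.snd ℝ (Fin n → ℝ) ((Fin n → ℝ) × ℝ))).hasFDerivAt

lemma differentiable_hsq (n : ℕ) : Differentiable ℝ (hsq n) := by
  unfold hsq
  fun_prop

lemma pd_hsq (n : ℕ) (v p : Heis n) :
    pd n v (hsq n) p = ∑ i, (2 * p.1 i * v.1 i + 2 * p.2.1 i * v.2.1 i) := by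
  have h : HasFDerivAt (hsq n) _ p := HasFDerivAt.fun_sum fun i (_ : i ∈ Finset.univ) =>
    ((hasFDerivAt_fst_apply n i p).pow 2).add ((hasFDerivAt_snd_fst_apply n i p).pow 2)
  rw [pd, h.fderiv]
  simp

lemma pd_mul (n : ℕ) (v p : Heis n) {f g : Heis n → ℝ} (hf : DifferentiableAt ℝ f p)
    (hg : DifferentiableAt ℝ g p) :
    pd n v (fun ζ => f ζ * g ζ) p = pd n v f p * g p + f p * pd n v g p := by
  have h : HasFDerivAt (fun ζ => f ζ * g ζ) _ p := hf.hasFDerivAt.mul hg.hasFDerivAt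
  rw [pd, h.fderiv]
  simp [pd]
  ring

lemma pd_comp (n : ℕ) (v p : Heis n) {f : Heis n → ℝ} {k : ℝ → ℝ} {k' : ℝ}
    (hk : HasDerivAt k k' (f p)) (hf : DifferentiableAt ℝ f p) :
    pd n v (fun ζ => k (f ζ)) p = k' * pd n v f p := by
  have h : HasFDerivAt (fun ζ => k (f ζ)) _ p := hk.comp_hasFDerivAt p hf.hasFDerivAt
  rw [pd, h.fderiv]
  simp [pd]

lemma differentiableAt_kor_sq (n : ℕ) {p : Heis n} (hp : 0 < kor n p ^ 2) :
    DifferentiableAt ℝ (fun ζ => kor n ζ ^ 2) p := by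
  have h := kor_sq_sq n p
  simp only [kor_sq]
  refine DifferentiableAt.sqrt ?_ (by rw [← h]; positivity)
  have := differentiable_hsq n
  fun_prop

lemma pd_kor_sq (n : ℕ) (v : Heis n) {p : Heis n} (hp : 0 < kor n p ^ 2) :
    pd n v (fun ζ => kor n ζ ^ 2) p =
      (hsq n p * pd n v (hsq n) p + p.2.2 * v.2.2) / kor n p ^ 2 := by
  have h := kor_sq_sq n p
  have hd : HasFDerivAt (fun ζ => hsq n ζ ^ 2 + ζ.2.2 ^ 2) _ p :=
    ((differentiable_hsq n p).hasFDerivAt.pow 2).add ((hasFDerivAt_snd_snd n p).pow 2)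
  have hs := hd.sqrt (by rw [← h]; positivity)
  simp only [← kor_sq] at hs
  rw [pd, hs.fderiv]
  simp [pd]
  field_simp

lemma pd_hsq_eX (n : ℕ) (i : Fin n) (p : Heis n) : pd n (eX n i) (hsq n) p = 2 * p.1 i := by
  simp [pd_hsq, eX, Pi.single_apply]

lemma pd_hsq_eY (n : ℕ) (i : Fin n) (p : Heis n) : pd n (eY n i) (hsq n) p = 2 * p.2.1 i := by
  simp [pd_hsq, eY, Pi.single_apply]

lemma pd_hsq_eT (n : ℕ) (p : Heis n) : pd n (eT n) (hsq n) p = 0 := by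
  simp [pd_hsq, eT]

lemma pd_congr (n : ℕ) (v : Heis n) {p : Heis n} {f g : Heis n → ℝ}
    (h : f =ᶠ[nhds p] g) : pd n v f p = pd n v g p := by
  rw [pd, pd, h.fderiv_eq]

/-- The sub-Laplacian of a function of `|η|_ℍ²`, away from the origin. -/
lemma subLap_comp_kor_sq (n : ℕ) {h : ℝ → ℝ} (hh : ContDiffOn ℝ 2 h (Set.Ioi 0))
    {p : Heis n} (hp : 0 < kor n p ^ 2) :
    subLap n (fun ζ => h (kor n ζ ^ 2)) p =
      4 * hsq n p * deriv (deriv h) (kor n p ^ 2)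
        + (4 * n + 4) * (hsq n p / kor n p ^ 2) * deriv h (kor n p ^ 2) := by
  have h1 : ∀ t : ℝ, 0 < t → HasDerivAt h (deriv h t) t := fun t ht =>
    ((hh.contDiffAt (Ioi_mem_nhds ht)).differentiableAt (by norm_num)).hasDerivAt
  have h2 : ∀ t : ℝ, 0 < t → HasDerivAt (deriv h) (deriv (deriv h) t) t := fun t ht =>
    (((hh.deriv_of_isOpen isOpen_Ioi (m := 1) (by norm_num)).contDiffAt
      (Ioi_mem_nhds ht)).differentiableAt (by norm_num)).hasDerivAt
  set w : Heis n → ℝ := fun ζ => kor n ζ ^ 2 with hw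
  have hev : ∀ᶠ ζ in nhds p, 0 < w ζ :=
    (continuous_kor_sq n).continuousAt.eventually (lt_mem_nhds hp)
  set k : ℝ → ℝ := fun t => deriv h t / t with hk
  have hkd : HasDerivAt k ((deriv (deriv h) (w p) * w p - deriv h (w p) * 1) / w p ^ 2) (w p) :=
    (h2 _ hp).div (hasDerivAt_id _) hp.ne'
  have hwd : DifferentiableAt ℝ w p := differentiableAt_kor_sq n hp
  have first : ∀ v : Heis n, pd n v (fun ζ => h (w ζ)) =ᶠ[nhds p]
      fun ζ => k (w ζ) * (hsq n ζ * pd n v (hsq n) ζ + ζ.2.2 * v.2.2) := by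
    intro v
    filter_upwards [hev] with ζ hζ
    rw [pd_comp n v ζ (h1 _ hζ) (differentiableAt_kor_sq n hζ), pd_kor_sq n v hζ]
    simp only [hk, hw]
    ring
  have hkw : DifferentiableAt ℝ (fun ζ => k (w ζ)) p :=
    (hkd.comp_hasFDerivAt p hwd.hasFDerivAt).differentiableAt
  have second : ∀ (u v : Heis n) (a : Heis n → ℝ), DifferentiableAt ℝ a p →
      (∀ ζ, hsq n ζ * pd n v (hsq n) ζ + ζ.2.2 * v.2.2 = a ζ) →
      pd n u (pd n v (fun ζ => h (w ζ))) p =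
        (deriv (deriv h) (w p) / w p - deriv h (w p) / w p ^ 2)
          * ((hsq n p * pd n u (hsq n) p + p.2.2 * u.2.2) / w p) * a p
        + deriv h (w p) / w p * pd n u a p := by
    intro u v a ha hav
    rw [pd_congr n u (first v)]
    simp only [hav]
    have hwu : pd n u w p = (hsq n p * pd n u (hsq n) p + p.2.2 * u.2.2) / w p :=
      pd_kor_sq n u hp
    rw [pd_mul n u p hkw ha, pd_comp n u p hkd hwd, hwu]
    have : w p ≠ 0 := hp.ne'
    simp only [hk]
    field_simp
  have hS := differentiable_hsq n
  have hX : ∀ i, pd n (eX n i) (pd n (eX n i) (fun ζ => h (w ζ))) p = _ := fun i =>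
    second (eX n i) (eX n i) (fun ζ => hsq n ζ * (2 * ζ.1 i)) (by fun_prop)
      (fun ζ => by rw [pd_hsq_eX]; simp [eX])
  have hY : ∀ i, pd n (eY n i) (pd n (eY n i) (fun ζ => h (w ζ))) p = _ := fun i =>
    second (eY n i) (eY n i) (fun ζ => hsq n ζ * (2 * ζ.2.1 i)) (by fun_prop)
      (fun ζ => by rw [pd_hsq_eY]; simp [eY])
  have hT : ∀ u, pd n u (pd n (eT n) (fun ζ => h (w ζ))) p = _ := fun u =>
    second u (eT n) (fun ζ => ζ.2.2) (by fun_prop)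
      (fun ζ => by rw [pd_hsq_eT]; simp [eT])
  have aX : ∀ i, pd n (eX n i) (fun ζ => hsq n ζ * (2 * ζ.1 i)) p
      = 4 * p.1 i ^ 2 + 2 * hsq n p := fun i => by
    rw [pd_mul n _ p (hS p) (by fun_prop), pd_hsq_eX, pd,
      ((hasFDerivAt_fst_apply n i p).const_mul 2).fderiv]
    simp [eX]
    ring
  have aY : ∀ i, pd n (eY n i) (fun ζ => hsq n ζ * (2 * ζ.2.1 i)) p
      = 4 * p.2.1 i ^ 2 + 2 * hsq n p := fun i => by
    rw [pd_mul n _ p (hS p) (by fun_prop), pd_hsq_eY, pd,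
      ((hasFDerivAt_snd_fst_apply n i p).const_mul 2).fderiv]
    simp [eY]
    ring
  have aT : ∀ u : Heis n, pd n u (fun ζ => ζ.2.2) p = u.2.2 := fun u => by
    rw [pd, (hasFDerivAt_snd_snd n p).fderiv]
    simp
  have hwN : w p ^ 2 = hsq n p ^ 2 + p.2.2 ^ 2 := kor_sq_sq n p
  have hw0 : w p ≠ 0 := hp.ne'
  change _ = 4 * hsq n p * deriv (deriv h) (w p)
        + (4 * n + 4) * (hsq n p / w p) * deriv h (w p)
  change (∑ i : Fin n, (pd n (eX n i) (pd n (eX n i) (fun ζ => h (w ζ))) p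
      + pd n (eY n i) (pd n (eY n i) (fun ζ => h (w ζ))) p))
    + 4 * hsq n p * pd n (eT n) (pd n (eT n) (fun ζ => h (w ζ))) p
    + 4 * ∑ i : Fin n, (p.2.1 i * pd n (eX n i) (pd n (eT n) (fun ζ => h (w ζ))) p
        - p.1 i * pd n (eY n i) (pd n (eT n) (fun ζ => h (w ζ))) p) = _
  simp only [hX, hY, hT, aX, aY, aT, pd_hsq_eX, pd_hsq_eY, pd_hsq_eT]
  generalize deriv (deriv h) (w p) = A
  generalize deriv h (w p) = B
  have e1 : ∀ i, (eX n i).2.2 = 0 := fun i => rfl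
  have e2 : ∀ i, (eY n i).2.2 = 0 := fun i => rfl
  have e3 : (eT n).2.2 = 1 := rfl
  simp only [e1, e2, e3]
  have mixed : ∑ i : Fin n, (p.2.1 i * ((A / w p - B / w p ^ 2)
      * ((hsq n p * (2 * p.1 i) + p.2.2 * 0) / w p) * p.2.2 + B / w p * 0)
      - p.1 i * ((A / w p - B / w p ^ 2)
      * ((hsq n p * (2 * p.2.1 i) + p.2.2 * 0) / w p) * p.2.2 + B / w p * 0)) = 0 :=
    Finset.sum_eq_zero fun i _ => by ring
  have diag : ∑ i : Fin n, ((A / w p - B / w p ^ 2)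
      * ((hsq n p * (2 * p.1 i) + p.2.2 * 0) / w p) * (hsq n p * (2 * p.1 i))
      + B / w p * (4 * p.1 i ^ 2 + 2 * hsq n p)
      + ((A / w p - B / w p ^ 2)
      * ((hsq n p * (2 * p.2.1 i) + p.2.2 * 0) / w p) * (hsq n p * (2 * p.2.1 i))
      + B / w p * (4 * p.2.1 i ^ 2 + 2 * hsq n p)))
      = ((A / w p - B / w p ^ 2) / w p * 4 * hsq n p ^ 2 + 4 * (B / w p)) * hsq n p
        + n * (4 * (B / w p) * hsq n p) := by
    have hc : (n : ℝ) * (4 * (B / w p) * hsq n p)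
        = ∑ _i : Fin n, 4 * (B / w p) * hsq n p := by simp
    rw [hc]
    nth_rw 8 [hsq]
    rw [Finset.mul_sum, ← Finset.sum_add_distrib]
    exact Finset.sum_congr rfl fun i _ => by ring
  rw [mixed, diag]
  have hN : hsq n p ^ 2 = w p ^ 2 - p.2.2 ^ 2 := by rw [hwN]; ring
  rw [hN]
  field_simp
  ring

/-- The anisotropic dilation `(x, y, τ) ↦ (a x, a y, a² τ)`. -/
def dilation (n : ℕ) {a : ℝ} (ha : a ≠ 0) : Heis n ≃ₜ Heis n :=
  (Homeomorph.smulOfNeZero a ha).prodCongr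
    ((Homeomorph.smulOfNeZero a ha).prodCongr (Homeomorph.smulOfNeZero (a ^ 2) (pow_ne_zero 2 ha)))

lemma kor_sq_dilation (n : ℕ) {a : ℝ} (ha : a ≠ 0) (p : Heis n) :
    kor n (dilation n ha p) ^ 2 = a ^ 2 * kor n p ^ 2 := by
  have h : hsq n (dilation n ha p) = a ^ 2 * hsq n p := by
    simp only [hsq, Finset.mul_sum]
    refine Finset.sum_congr rfl fun i _ => ?_
    change (a * p.1 i) ^ 2 + (a * p.2.1 i) ^ 2 = _
    ring
  rw [kor_sq, kor_sq, h]
  change √((a ^ 2 * hsq n p) ^ 2 + (a ^ 2 * p.2.2) ^ 2) = _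
  rw [← Real.sqrt_sq (show 0 ≤ a ^ 2 by positivity), ← Real.sqrt_mul (by positivity),
    Real.sqrt_sq (show 0 ≤ a ^ 2 by positivity)]
  congr 1
  ring

lemma map_dilation_volume (n : ℕ) {a : ℝ} (ha : 0 < a) :
    (volume : Measure (Heis n)).map (dilation n ha.ne')
      = ENNReal.ofReal ((a ^ (2 * n + 2))⁻¹) • volume := by
  have hpi := Measure.map_addHaar_smul (volume : Measure (Fin n → ℝ)) ha.ne'
  have hre := Measure.map_addHaar_smul (volume : Measure ℝ) (pow_ne_zero 2 ha.ne')
  have hfin : ((volume : Measure (Fin n → ℝ)).prod (volume : Measure ℝ)).map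
      (Prod.map (a • ·) (a ^ 2 • ·)) = _ :=
    (Measure.map_prod_map _ _ (measurable_const_smul a) (measurable_const_smul (a ^ 2))).symm
  have hall : ((volume : Measure (Fin n → ℝ)).prod
      ((volume : Measure (Fin n → ℝ)).prod (volume : Measure ℝ))).map
      (Prod.map (a • ·) (Prod.map (a • ·) (a ^ 2 • ·))) = _ :=
    (Measure.map_prod_map _ _ (measurable_const_smul a)
      ((measurable_const_smul a).prodMap (measurable_const_smul (a ^ 2)))).symm
  rw [hfin, hpi, hre] at hall
  change ((volume : Measure (Fin n → ℝ)).prod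
      ((volume : Measure (Fin n → ℝ)).prod (volume : Measure ℝ))).map
      (Prod.map (a • ·) (Prod.map (a • ·) (a ^ 2 • ·))) = _
  rw [hall]
  simp only [Measure.prod_smul_left, Measure.prod_smul_right, smul_smul]
  rw [← ENNReal.ofReal_mul (by positivity), ← ENNReal.ofReal_mul (by positivity)]
  congr 2
  simp only [Module.finrank_fintype_fun_eq_card, Fintype.card_fin, Module.finrank_self]
  rw [abs_of_pos (by positivity), abs_of_pos (by positivity)]
  field_simp
  ring

lemma integrable_comp_dilation (n : ℕ) {a : ℝ} (ha : 0 < a) {F : Heis n → ℝ}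
    (hF : Integrable F) : Integrable fun p => F (dilation n ha.ne' p) := by
  refine ((dilation n ha.ne').measurableEmbedding.integrable_map_iff (f := dilation n ha.ne')).1 ?_
  rw [map_dilation_volume n ha]
  exact hF.smul_measure ENNReal.ofReal_ne_top

lemma integral_comp_dilation (n : ℕ) {a : ℝ} (ha : 0 < a) (F : Heis n → ℝ) :
    ∫ p, F (dilation n ha.ne' p) = (a ^ (2 * n + 2))⁻¹ * ∫ p, F p := by
  rw [← (dilation n ha.ne').measurableEmbedding.integral_map (f := dilation n ha.ne'),
    map_dilation_volume n ha, integral_smul_measure, ENNReal.toReal_ofReal (by positivity),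
    smul_eq_mul]

/-- The sub-Laplacian of the rescaled cut-off is controlled by the derivatives of its profile. -/
lemma abs_subLap_cutoff_le (n : ℕ) {Φ : ℝ → ℝ} (hΦ : ContDiffOn ℝ 2 Φ (Set.Ici 0))
    {R : ℝ} (hR : 0 < R) {p : Heis n} (hp : 0 < kor n p ^ 2) (hpR : kor n p ^ 2 / R ^ 2 ≤ 1) :
    |subLap n (fun ζ => Φ (kor n ζ ^ 2 / R ^ 2)) p| ≤ (4 * n + 4) / R ^ 2 *
      (|deriv (deriv Φ) (kor n p ^ 2 / R ^ 2)| + |deriv Φ (kor n p ^ 2 / R ^ 2)|) := by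
  set c : ℝ := (R ^ 2)⁻¹ with hc
  have hcpos : 0 < c := by positivity
  have hh : ContDiffOn ℝ 2 (fun t => Φ (c * t)) (Set.Ioi 0) :=
    hΦ.comp (by fun_prop) fun t ht => (mul_pos hcpos ht).le
  have d1 : deriv (fun t => Φ (c * t)) = fun t => c * deriv Φ (c * t) :=
    funext fun t => deriv_comp_mul_left c Φ t
  have d2 : deriv (fun t => c * deriv Φ (c * t)) = fun t => c * (c * deriv (deriv Φ) (c * t)) :=
    funext fun t => by
      rw [deriv_const_mul_field, deriv_comp_mul_left c (deriv Φ) t, smul_eq_mul]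
  have key := subLap_comp_kor_sq n hh hp
  rw [d1, d2] at key
  have hdiv : ∀ t : ℝ, t / R ^ 2 = c * t := fun t => by rw [hc]; ring
  simp only [hdiv] at hpR ⊢
  rw [key]
  beta_reduce
  have hs0 := hsq_nonneg n p
  have hs := hsq_le_kor_sq n p
  have hcs : c * hsq n p ≤ 1 := (mul_le_mul_of_nonneg_left hs hcpos.le).trans hpR
  have hsw : hsq n p / kor n p ^ 2 ≤ 1 := (div_le_one hp).2 hs
  have hsw0 : 0 ≤ hsq n p / kor n p ^ 2 := by positivity
  generalize hsq n p / kor n p ^ 2 = r at hsw hsw0 ⊢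
  generalize hsq n p = s at *
  generalize deriv (deriv Φ) (c * kor n p ^ 2) = A
  generalize deriv Φ (c * kor n p ^ 2) = B
  have hn : (0 : ℝ) ≤ n := n.cast_nonneg
  have e : 4 * s * (c * (c * A)) + (4 * n + 4) * r * (c * B)
      = c * (4 * (c * s)) * A + c * ((4 * n + 4) * r) * B := by ring
  rw [e]
  refine (abs_add_le _ _).trans ?_
  rw [abs_mul _ A, abs_mul _ B, abs_of_nonneg (by positivity : 0 ≤ c * (4 * (c * s))),
    abs_of_nonneg (by positivity : 0 ≤ c * ((4 * n + 4) * r))]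
  have t1 : c * (4 * (c * s)) ≤ c * (4 * n + 4) := by nlinarith [mul_nonneg hn hcpos.le]
  have t2 : c * ((4 * n + 4) * r) ≤ c * (4 * n + 4) := by
    nlinarith [mul_nonneg hn hcpos.le, mul_le_mul_of_nonneg_left hsw
      (by positivity : 0 ≤ c * (4 * n + 4))]
  rw [mul_add]
  gcongr

lemma subLap_eq_zero_of_eventuallyEq_const (n : ℕ) {f : Heis n → ℝ} {c : ℝ} {p : Heis n}
    (h : f =ᶠ[nhds p] fun _ => c) : subLap n f p = 0 := by
  have h1 : ∀ v, pd n v f =ᶠ[nhds p] fun _ => 0 := fun v => by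
    filter_upwards [h.eventually_nhds] with ζ hζ
    rw [pd_congr n v hζ, pd]
    simp
  have h2 : ∀ u v, pd n u (pd n v f) p = 0 := fun u v => by
    rw [pd_congr n u (h1 v), pd]
    simp
  simp [subLap, h2]

/-- **Lemma 2.2, estimate `I₄`.** For the cut-off `φ₂(η) = Φ(|η|_ℍ²/R²)` one has
`∫_{ℍⁿ} φ₂^{-1/(q-1)} |Δ_ℍ φ₂|^{q'} dη ≤ C R^{Q-2q'}` with `C` independent of `R > 0`
(the integrand being interpreted as `0` where `φ₂ = 0`). -/
theorem integral_I4 (n Q : ℕ) (hn : 1 ≤ n) (hQ : Q = 2 * n + 2)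
    (q q' : ℝ) (hq : 1 < q) (hq' : q' = q / (q - 1))
    (Φ : ℝ → ℝ) (hΦ : ContDiffOn ℝ 2 Φ (Set.Ici 0))
    (hΦrange : ∀ z ∈ Set.Ici (0 : ℝ), Φ z ∈ Set.Icc (0 : ℝ) 1)
    (hΦone : ∀ z ∈ Set.Icc (0 : ℝ) (1 / 2), Φ z = 1)
    (hΦzero : ∀ z : ℝ, 1 ≤ z → Φ z = 0)
    (hC₄ : MeasureTheory.IntegrableOn
      (fun η : Heis n => Φ (kor n η ^ 2) ^ (-(1 : ℝ) / (q - 1))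
        * (|deriv (deriv Φ) (kor n η ^ 2)| + |deriv Φ (kor n η ^ 2)|) ^ q')
      {η : Heis n | 1 / 2 ≤ kor n η ^ 2 ∧ kor n η ^ 2 ≤ 1} volume) :
    ∃ C : ℝ, 0 < C ∧ ∀ R : ℝ, 0 < R →
      (∫ η : Heis n,
          if Φ (kor n η ^ 2 / R ^ 2) = 0 then 0
          else Φ (kor n η ^ 2 / R ^ 2) ^ (-(1 : ℝ) / (q - 1))
            * |subLap n (fun ζ => Φ (kor n ζ ^ 2 / R ^ 2)) η| ^ q')
        ≤ C * R ^ ((Q : ℝ) - 2 * q') := by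
  have hq0 : 0 < q - 1 := by linarith
  have hq'0 : 0 < q' := by rw [hq']; exact div_pos (by linarith) hq0
  set A : Set (Heis n) := {η | 1 / 2 ≤ kor n η ^ 2 ∧ kor n η ^ 2 ≤ 1} with hA
  have hAm : MeasurableSet A :=
    ((isClosed_le continuous_const (continuous_kor_sq n)).inter
      (isClosed_le (continuous_kor_sq n) continuous_const)).measurableSet
  set F : Heis n → ℝ := fun η => Φ (kor n η ^ 2) ^ (-(1 : ℝ) / (q - 1))
        * (|deriv (deriv Φ) (kor n η ^ 2)| + |deriv Φ (kor n η ^ 2)|) ^ q' with hF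
  have hFi : Integrable (A.indicator F) := (integrable_indicator_iff hAm).2 hC₄
  have hΦ0 : ∀ t : ℝ, 0 ≤ t → 0 ≤ Φ t := fun t ht => (hΦrange t ht).1
  have hF0 : ∀ η, 0 ≤ A.indicator F η := Set.indicator_nonneg fun η _ =>
    mul_nonneg (Real.rpow_nonneg (hΦ0 _ (sq_nonneg _)) _) (by positivity)
  have hI0 : 0 ≤ ∫ η, A.indicator F η := integral_nonneg hF0
  refine ⟨(4 * n + 4) ^ q' * (∫ η, A.indicator F η) + 1, by positivity, fun R hR => ?_⟩
  have hRi : 0 < R⁻¹ := inv_pos.2 hR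
  have hdil : ∀ η : Heis n, kor n (dilation n hRi.ne' η) ^ 2 = kor n η ^ 2 / R ^ 2 := fun η => by
    rw [kor_sq_dilation, inv_pow, div_eq_inv_mul]
  set G : Heis n → ℝ := fun η =>
    ((4 * n + 4) / R ^ 2) ^ q' * A.indicator F (dilation n hRi.ne' η) with hG
  have hGi : Integrable G := (integrable_comp_dilation n hRi hFi).const_mul _
  have hle : ∫ η : Heis n, (if Φ (kor n η ^ 2 / R ^ 2) = 0 then 0
          else Φ (kor n η ^ 2 / R ^ 2) ^ (-(1 : ℝ) / (q - 1))
            * |subLap n (fun ζ => Φ (kor n ζ ^ 2 / R ^ 2)) η| ^ q') ≤ ∫ η, G η := by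
    refine integral_mono_of_nonneg (Filter.Eventually.of_forall fun η => ?_) hGi
      (Filter.Eventually.of_forall fun η => ?_)
    · dsimp only [Pi.zero_apply]
      split_ifs
      · exact le_rfl
      · exact mul_nonneg (Real.rpow_nonneg (hΦ0 _ (by positivity)) _) (by positivity)
    · have hG0 : 0 ≤ G η := mul_nonneg (by positivity) (hF0 _)
      dsimp only
      split_ifs with hz
      · exact hG0
      rcases lt_or_ge (kor n η ^ 2 / R ^ 2) (1 / 2) with hlt | hge
      · have hconst : (fun ζ : Heis n => Φ (kor n ζ ^ 2 / R ^ 2)) =ᶠ[nhds η] fun _ => 1 := by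
          filter_upwards [((continuous_kor_sq n).div_const (R ^ 2)).continuousAt.eventually
            (gt_mem_nhds hlt)] with ζ hζ
          exact hΦone _ ⟨by positivity, hζ.le⟩
        rw [subLap_eq_zero_of_eventuallyEq_const n hconst, abs_zero,
          Real.zero_rpow hq'0.ne', mul_zero]
        exact hG0
      · have hle1 : kor n η ^ 2 / R ^ 2 ≤ 1 := by
          by_contra! hgt
          exact hz (hΦzero _ hgt.le)
        have hpos : 0 < kor n η ^ 2 := by
          have : 0 < kor n η ^ 2 / R ^ 2 := by linarith
          rcases (sq_nonneg (kor n η)).lt_or_eq with h | h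
          · exact h
          · rw [← h, zero_div] at this
            exact absurd this (lt_irrefl _)
        have hmem : dilation n hRi.ne' η ∈ A :=
          ⟨by rwa [hdil], by rwa [hdil]⟩
        simp only [hG, Set.indicator_of_mem hmem, hF, hdil]
        rw [mul_left_comm, ← Real.mul_rpow (by positivity) (by positivity)]
        refine mul_le_mul_of_nonneg_left ?_ (Real.rpow_nonneg (hΦ0 _ (by positivity)) _)
        exact Real.rpow_le_rpow (abs_nonneg _) (abs_subLap_cutoff_le n hΦ hR hpos hle1) hq'0.le
  refine hle.trans ?_
  have hpow : ((R⁻¹ ^ (2 * n + 2))⁻¹ : ℝ) / (R ^ 2) ^ q' = R ^ ((Q : ℝ) - 2 * q') := by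
    rw [inv_pow, inv_inv, Real.rpow_sub hR, Real.rpow_natCast, hQ, Real.rpow_mul hR.le]
    norm_num
  rw [hG, integral_const_mul, integral_comp_dilation n hRi,
    Real.div_rpow (by positivity) (by positivity), ← hpow]
  have hfac : (0 : ℝ) ≤ (R⁻¹ ^ (2 * n + 2))⁻¹ / (R ^ 2) ^ q' := by positivity
  calc _ = ((4 * n + 4) ^ q' * ∫ η, A.indicator F η)
        * ((R⁻¹ ^ (2 * n + 2))⁻¹ / (R ^ 2) ^ q') := by ring
    _ ≤ _ := mul_le_mul_of_nonneg_right (by linarith) hfac
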